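/- arXiv:2003.03907 — 2 statements merged into one kernel-verified Lean document; each statement's English description precedes it below -/
import Mathlib

section
/- For the two-row partition λ = (λ_1, λ_2) with λ_1 ≥ λ_2 ≥ 1, the formula g_λ = det[[h_{λ_1}, h_{λ_1+1}], [φ(h_{λ_2 - 1}), φ(h_{λ_2})]] holds, where φ(h_n) = h_0 + ⋯ + h_n; explicitly g_{(λ_1,λ_2)} = h_{λ_1}(h_{λ_2} + h_{λ_2-1} + ⋯ + h_0) − h_{λ_1+1}(h_{λ_2-1} + ⋯ + h_0), and this symmetric function equals the RPP generating function ∑_{T ∈ RPP(λ)} ∏_i x_i^{c_i(T)}. -/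
open scoped Classical

/-- The complete homogeneous symmetric polynomial of degree `n` evaluated at `x : Fin N → R`. -/
def hpoly {R : Type*} [CommSemiring R] {N : ℕ} (n : ℕ) (x : Fin N → R) : R :=
  ∑ d ∈ Finset.Nat.antidiagonalTuple N n, ∏ i, x i ^ d i

/-- The complete homogeneous polynomials are invariant under reversing the variables. -/
lemma hpoly_comp_rev {R : Type*} [CommSemiring R] {N : ℕ} (n : ℕ) (x : Fin N → R) :
    hpoly n (fun i => x i.rev) = hpoly n x := by
  unfold hpoly
  refine Finset.sum_equiv (Equiv.arrowCongr Fin.revPerm (Equiv.refl ℕ)) ?_ ?_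
  · intro d
    simp only [Finset.Nat.mem_antidiagonalTuple]
    rw [← Equiv.sum_comp Fin.revPerm]
    simp [Equiv.arrowCongr]
  · intro d _
    rw [← Equiv.prod_comp Fin.revPerm]
    simp [Equiv.arrowCongr]

lemma hpoly_cons {R : Type*} [CommSemiring R] {N : ℕ} (n : ℕ) (x : Fin (N + 1) → R) :
    hpoly n x = ∑ p ∈ Finset.HasAntidiagonal.antidiagonal n, x 0 ^ p.1 * hpoly p.2 (fun i => x i.succ) := by
  simp only [hpoly, Finset.mul_sum, Finset.sum_sigma']
  refine Finset.sum_bij' (fun d _ => ⟨(d 0, ∑ i : Fin N, d i.succ), Fin.tail d⟩)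
    (fun p _ => Fin.cons p.1.1 p.2) ?_ ?_ ?_ ?_ ?_
  · intro d hd
    simpa [Finset.Nat.mem_antidiagonalTuple, Fin.sum_univ_succ, Fin.tail] using hd
  · rintro ⟨⟨i, j⟩, d⟩ hd
    simp only [Finset.mem_sigma, Finset.HasAntidiagonal.mem_antidiagonal,
      Finset.Nat.mem_antidiagonalTuple] at hd
    simp [Finset.Nat.mem_antidiagonalTuple, Fin.sum_univ_succ, hd]
  · intro d _
    simp
  · rintro ⟨⟨i, j⟩, d⟩ hd
    simp only [Finset.mem_sigma, Finset.HasAntidiagonal.mem_antidiagonal,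
      Finset.Nat.mem_antidiagonalTuple] at hd
    simp [hd]
  · intro d _
    simp [Fin.prod_univ_succ, Fin.tail]

lemma hpoly_succ_cons {R : Type*} [CommSemiring R] {N : ℕ} (n : ℕ) (x : Fin (N + 1) → R) :
    hpoly (n + 1) x = hpoly (n + 1) (fun i => x i.succ) + x 0 * hpoly n x := by
  rw [hpoly_cons, Finset.Nat.antidiagonal_succ, hpoly_cons n x]
  simp [Finset.mul_sum, pow_succ', mul_assoc]

/-- Splitting off the last variable. -/
lemma hpoly_succ_snoc {R : Type*} [CommSemiring R] {N : ℕ} (n : ℕ) (x : Fin (N + 1) → R) :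
    hpoly (n + 1) x =
      hpoly (n + 1) (fun i : Fin N => x i.castSucc) + x (Fin.last N) * hpoly n x := by
  rw [← hpoly_comp_rev (n + 1) x, hpoly_succ_cons, hpoly_comp_rev n x,
    ← hpoly_comp_rev (n + 1) (fun i : Fin N => x i.castSucc)]
  simp [Fin.rev_succ]

@[simp] lemma hpoly_zero {R : Type*} [CommSemiring R] {N : ℕ} (x : Fin N → R) :
    hpoly 0 x = 1 := by
  simp [hpoly, Finset.Nat.antidiagonalTuple_zero_right]

lemma hpoly_succ_fin_zero {R : Type*} [CommSemiring R] (n : ℕ) (x : Fin 0 → R) :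
    hpoly (n + 1) x = 0 := by
  simp [hpoly]

/-- The complete homogeneous polynomial in the first `k` variables of a sequence. -/
def hinit {R : Type*} [CommSemiring R] (y : ℕ → R) (n k : ℕ) : R :=
  hpoly n (fun i : Fin k => y i)

section Initial

variable {R : Type*} [CommRing R] (y : ℕ → R)

@[simp] lemma hinit_zero (k : ℕ) : hinit y 0 k = 1 := hpoly_zero _

lemma hinit_succ_succ (n k : ℕ) :
    hinit y (n + 1) (k + 1) = hinit y (n + 1) k + y k * hinit y n (k + 1) :=
  hpoly_succ_snoc n fun i : Fin (k + 1) => y i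

/-- Expansion according to the largest variable that occurs. -/
lemma sum_mul_hinit (n k : ℕ) :
    ∑ c ∈ Finset.range k, y c * hinit y n (c + 1) = hinit y (n + 1) k := by
  induction k with
  | zero => exact (hpoly_succ_fin_zero n _).symm
  | succ k ih => rw [Finset.sum_range_succ, ih, hinit_succ_succ]

/-- The sum of the complete homogeneous polynomials of degree less than `n` in the first `k`
variables. -/
def hinitSum (n k : ℕ) : R := ∑ q ∈ Finset.range n, hinit y q k

lemma hinitSum_succ (n k : ℕ) : hinitSum y (n + 1) k = hinitSum y n k + hinit y n k :=
  Finset.sum_range_succ _ _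

lemma sum_mul_hinitSum (n : ℕ) {j k : ℕ} (hjk : j ≤ k) :
    ∑ d ∈ Finset.Ico j k, y d * hinitSum y n (d + 1) =
      hinitSum y (n + 1) k - hinitSum y (n + 1) j := by
  have key (k : ℕ) :
      ∑ d ∈ Finset.range k, y d * hinitSum y n (d + 1) = hinitSum y (n + 1) k - 1 := by
    simp only [hinitSum, Finset.mul_sum]
    rw [Finset.sum_comm, Finset.sum_range_succ']
    simp [sum_mul_hinit]
  rw [Finset.sum_Ico_eq_sub _ hjk, key, key]
  ring

/-- The two-row determinant in which the first row uses `a` and the second row `b` variables. -/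
def twoRowDet (l1 l2 a b : ℕ) : R :=
  hinit y l1 a * hinitSum y (l2 + 1) b - hinit y (l1 + 1) a * hinitSum y l2 b

lemma sum_mul_twoRowDet (l1 l2 a b : ℕ) :
    ∑ c ∈ Finset.range a, y c * twoRowDet y l1 l2 (c + 1) b = twoRowDet y (l1 + 1) l2 a b := by
  simp only [twoRowDet, mul_sub, Finset.sum_sub_distrib, ← mul_assoc, ← Finset.sum_mul,
    sum_mul_hinit]

lemma sum_column_twoRowDet (n : ℕ) {c b : ℕ} (hcb : c < b) :
    ∑ d ∈ Finset.Ico c b, (if c = d then y d else y c * y d) * twoRowDet y n n (c + 1) (d + 1) =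
      y c * (hinit y n (c + 1) * hinitSum y (n + 2) b -
        hinit y (n + 1) (c + 1) * hinitSum y (n + 1) b) := by
  have key : ∑ d ∈ Finset.Ico (c + 1) b,
      (if c = d then y d else y c * y d) * twoRowDet y n n (c + 1) (d + 1) =
      y c * (hinit y n (c + 1) * (hinitSum y (n + 2) b - hinitSum y (n + 2) (c + 1)) -
        hinit y (n + 1) (c + 1) * (hinitSum y (n + 1) b - hinitSum y (n + 1) (c + 1))) := by
    rw [← sum_mul_hinitSum y (n + 1) hcb, ← sum_mul_hinitSum y n hcb, Finset.mul_sum,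
      Finset.mul_sum, ← Finset.sum_sub_distrib, Finset.mul_sum]
    refine Finset.sum_congr rfl fun d hd => ?_
    rw [if_neg (by have := Finset.mem_Ico.1 hd; omega), twoRowDet]
    ring
  rw [Finset.sum_eq_sum_Ico_succ_bot hcb, key, if_pos rfl, twoRowDet,
    hinitSum_succ y (n + 1) (c + 1), hinitSum_succ y n (c + 1)]
  ring

lemma sum_sum_column_twoRowDet (n : ℕ) {a b : ℕ} (hab : a ≤ b) :
    ∑ c ∈ Finset.range a, ∑ d ∈ Finset.Ico c b,
      (if c = d then y d else y c * y d) * twoRowDet y n n (c + 1) (d + 1) =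
      twoRowDet y (n + 1) (n + 1) a b := by
  rw [Finset.sum_congr rfl fun c hc =>
    sum_column_twoRowDet y n ((Finset.mem_range.1 hc).trans_le hab)]
  simp only [twoRowDet, mul_sub, Finset.sum_sub_distrib, ← mul_assoc, ← Finset.sum_mul,
    sum_mul_hinit]

end Initial

lemma sum_fin_ite_eq_sum_filter_range {R : Type*} [AddCommMonoid R] {m : ℕ} (p : ℕ → Prop) [DecidablePred p]
    (f : ℕ → R) :
    (∑ c : Fin m, if p c then f c else 0) = ∑ c ∈ (Finset.range m).filter p, f c := by
  rw [Finset.sum_filter, ← Fin.sum_univ_eq_sum_range (fun c => if p c then f c else 0)]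

lemma sum_fun_fin_succ {α R : Type*} [Fintype α] [AddCommMonoid R] {n : ℕ}
    (f : (Fin (n + 1) → α) → R) :
    ∑ g, f g = ∑ c : α, ∑ g : Fin n → α, f (Fin.snoc g c) := by
  rw [← Fintype.sum_prod_type']
  exact (Equiv.sum_comp (Fin.snocEquiv fun _ => α) f).symm

lemma monotone_snoc_iff {α : Type*} [Preorder α] {n : ℕ} (g : Fin n → α) (c : α) :
    Monotone (Fin.snoc g c : Fin (n + 1) → α) ↔ Monotone g ∧ ∀ j, g j ≤ c := by
  refine ⟨fun h => ⟨fun i j hij => ?_, fun j => ?_⟩, fun ⟨h, hc⟩ i j hij => ?_⟩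
  · simpa using h (Fin.castSucc_le_castSucc_iff.2 hij)
  · simpa using h (Fin.le_last j.castSucc)
  · induction j using Fin.lastCases with
    | last => induction i using Fin.lastCases with
      | last => simp
      | cast i => simpa using hc i
    | cast j => induction i using Fin.lastCases with
      | last => exact absurd hij (by simp [Fin.le_def])
      | cast i => simpa using h (Fin.castSucc_le_castSucc_iff.1 hij)

section ReversePlanePartition

variable {m l1 l2 : ℕ}

/-- Two-row reverse plane partitions with entries of the first row below `a` and entries of the
second row below `b`. -/
def IsBoundedRPP (h : l2 ≤ l1) (a b : ℕ) (S : Fin l1 → Fin m) (T : Fin l2 → Fin m) : Prop :=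
  (Monotone S ∧ Monotone T ∧ ∀ j : Fin l2, S (Fin.castLE h j) ≤ T j) ∧
    (∀ j, (S j : ℕ) < a) ∧ ∀ j, (T j : ℕ) < b

lemma isBoundedRPP_snoc_left (h : l2 ≤ l1) (a b : ℕ) (S : Fin l1 → Fin m) (c : Fin m)
    (T : Fin l2 → Fin m) :
    IsBoundedRPP (h.trans l1.le_succ) a b (Fin.snoc S c : Fin (l1 + 1) → Fin m) T ↔
      (c : ℕ) < a ∧ IsBoundedRPP h (c + 1) b S T := by
  have hcol (j : Fin l2) : (Fin.snoc S c : Fin (l1 + 1) → Fin m)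
      (Fin.castLE (h.trans l1.le_succ) j) = S (Fin.castLE h j) :=
    Fin.snoc_castSucc (α := fun _ => Fin m) c S (Fin.castLE h j)
  simp only [IsBoundedRPP, monotone_snoc_iff, hcol, Fin.forall_fin_succ', Fin.snoc_castSucc,
    Fin.snoc_last, Nat.lt_succ_iff, Fin.le_def]
  constructor
  · rintro ⟨⟨⟨h1, h2⟩, h3, h4⟩, ⟨-, h6⟩, h7⟩
    exact ⟨h6, ⟨h1, h3, h4⟩, h2, h7⟩
  · rintro ⟨h6, ⟨h1, h3, h4⟩, h2, h7⟩
    exact ⟨⟨⟨h1, h2⟩, h3, h4⟩, ⟨fun j => (h2 j).trans_lt h6, h6⟩, h7⟩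

lemma isBoundedRPP_snoc_snoc {n : ℕ} (a b : ℕ) (S T : Fin n → Fin m) (c d : Fin m) :
    IsBoundedRPP (le_refl (n + 1)) a b (Fin.snoc S c : Fin (n + 1) → Fin m)
      (Fin.snoc T d : Fin (n + 1) → Fin m) ↔
      ((c : ℕ) < a ∧ (c : ℕ) ≤ d ∧ (d : ℕ) < b) ∧
        IsBoundedRPP (le_refl n) (c + 1) (d + 1) S T := by
  simp only [IsBoundedRPP, monotone_snoc_iff, Fin.castLE_rfl, id, Fin.forall_fin_succ',
    Fin.snoc_castSucc, Fin.snoc_last, Nat.lt_succ_iff, Fin.le_def]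
  constructor
  · rintro ⟨⟨⟨h1, h2⟩, ⟨h3, h4⟩, h5, h6⟩, ⟨-, h8⟩, -, h9⟩
    exact ⟨⟨h8, h6, h9⟩, ⟨h1, h3, h5⟩, h2, h4⟩
  · rintro ⟨⟨h8, h6, h9⟩, ⟨h1, h3, h5⟩, h2, h4⟩
    exact ⟨⟨⟨h1, h2⟩, ⟨h3, h4⟩, h5, h6⟩, ⟨fun j => (h2 j).trans_lt h8, h8⟩,
      fun j => (h4 j).trans_lt h9, h9⟩

variable {R : Type*} [CommRing R]

/-- The weight of a two-row filling. -/
def rppWeight (x : Fin m → R) (h : l2 ≤ l1) (S : Fin l1 → Fin m) (T : Fin l2 → Fin m) : R :=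
  (∏ j : Fin l2,
      if S (Fin.castLE h j) = T j then x (T j) else x (S (Fin.castLE h j)) * x (T j)) *
    ∏ j ∈ Finset.univ.filter (fun j : Fin l1 => l2 ≤ (j : ℕ)), x (S j)

lemma rppWeight_snoc_left (x : Fin m → R) (h : l2 ≤ l1) (S : Fin l1 → Fin m) (c : Fin m)
    (T : Fin l2 → Fin m) :
    rppWeight x (h.trans l1.le_succ) (Fin.snoc S c : Fin (l1 + 1) → Fin m) T =
      x c * rppWeight x h S T := by
  have hcol (j : Fin l2) : (Fin.snoc S c : Fin (l1 + 1) → Fin m)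
      (Fin.castLE (h.trans l1.le_succ) j) = S (Fin.castLE h j) :=
    Fin.snoc_castSucc (α := fun _ => Fin m) c S (Fin.castLE h j)
  simp only [rppWeight, hcol, Finset.prod_filter, Fin.prod_univ_castSucc (n := l1),
    Fin.snoc_castSucc, Fin.snoc_last, Fin.val_castSucc, Fin.val_last, if_pos h]
  ring

lemma rppWeight_snoc_snoc {n : ℕ} (x : Fin m → R) (S T : Fin n → Fin m) (c d : Fin m) :
    rppWeight x (le_refl (n + 1)) (Fin.snoc S c : Fin (n + 1) → Fin m)
      (Fin.snoc T d : Fin (n + 1) → Fin m) =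
      (if c = d then x d else x c * x d) * rppWeight x (le_refl n) S T := by
  have hempty (k : ℕ) : Finset.univ.filter (fun j : Fin k => k ≤ (j : ℕ)) = ∅ := by
    ext j
    simp
  simp only [rppWeight, hempty, Finset.prod_empty, Fin.castLE_rfl, id,
    Fin.prod_univ_castSucc (n := n), Fin.snoc_castSucc, Fin.snoc_last]
  ring

/-- The generating function of bounded two-row reverse plane partitions. -/
noncomputable def rppSum (x : Fin m → R) (h : l2 ≤ l1) (a b : ℕ) : R :=
  ∑ S : Fin l1 → Fin m, ∑ T : Fin l2 → Fin m,
    if IsBoundedRPP h a b S T then rppWeight x h S T else 0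

lemma rppSum_succ_left (x : Fin m → R) (h : l2 ≤ l1) (a b : ℕ) :
    rppSum x (h.trans l1.le_succ) a b =
      ∑ c : Fin m, if (c : ℕ) < a then x c * rppSum x h (c + 1) b else 0 := by
  rw [rppSum, sum_fun_fin_succ]
  refine Finset.sum_congr rfl fun c _ => ?_
  simp only [isBoundedRPP_snoc_left h, rppWeight_snoc_left x h]
  by_cases hc : (c : ℕ) < a <;> simp [hc, rppSum, Finset.mul_sum]

lemma rppSum_succ_succ (x : Fin m → R) (n a b : ℕ) :
    rppSum x (le_refl (n + 1)) a b =
      ∑ c : Fin m, ∑ d : Fin m, if (c : ℕ) < a ∧ (c : ℕ) ≤ d ∧ (d : ℕ) < b then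
        (if c = d then x d else x c * x d) * rppSum x (le_refl n) (c + 1) (d + 1) else 0 := by
  rw [rppSum, sum_fun_fin_succ]
  refine Finset.sum_congr rfl fun c _ => ?_
  rw [Finset.sum_congr rfl fun S _ => sum_fun_fin_succ _, Finset.sum_comm]
  refine Finset.sum_congr rfl fun d _ => ?_
  simp only [isBoundedRPP_snoc_snoc, rppWeight_snoc_snoc]
  by_cases hc : (c : ℕ) < a ∧ (c : ℕ) ≤ d ∧ (d : ℕ) < b
  · simp only [hc, rppSum, Finset.mul_sum, mul_ite, mul_zero, and_self, true_and, if_true]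
  · simp only [hc, false_and, if_false, Finset.sum_const_zero]

lemma rppSum_self_eq_twoRowDet (y : ℕ → R) (n : ℕ) {a b : ℕ} (hab : a ≤ b) (hb : b ≤ m) :
    rppSum (fun i : Fin m => y i) (le_refl n) a b = twoRowDet y n n a b := by
  induction n generalizing a b with
  | zero =>
    simp [rppSum, IsBoundedRPP, rppWeight, twoRowDet, hinitSum, Subsingleton.monotone]
  | succ n ih =>
    rw [rppSum_succ_succ, ← sum_sum_column_twoRowDet y n hab]
    have hrange : Finset.range a = (Finset.range m).filter (· < a) := by
      ext c
      simp only [Finset.mem_range, Finset.mem_filter]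
      omega
    rw [hrange, ← sum_fin_ite_eq_sum_filter_range]
    refine Finset.sum_congr rfl fun c _ => ?_
    split_ifs with hc
    · have hIco : Finset.Ico (c : ℕ) b =
          (Finset.range m).filter (fun d => (c : ℕ) ≤ d ∧ d < b) := by
        ext d
        simp only [Finset.mem_Ico, Finset.mem_range, Finset.mem_filter]
        omega
      rw [hIco, ← sum_fin_ite_eq_sum_filter_range]
      refine Finset.sum_congr rfl fun d _ => ?_
      by_cases hd : (c : ℕ) ≤ d ∧ (d : ℕ) < b
      · rw [if_pos ⟨hc, hd⟩, if_pos hd, ih (by omega) (by omega)]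
        simp only [Fin.ext_iff]
      · rw [if_neg fun h => hd h.2, if_neg hd]
    · simp [hc]

lemma rppSum_eq_twoRowDet (y : ℕ → R) (h : l2 ≤ l1) {a b : ℕ} (hab : a ≤ b) (hb : b ≤ m) :
    rppSum (fun i : Fin m => y i) h a b = twoRowDet y l1 l2 a b := by
  induction l1, h using Nat.le_induction generalizing a with
  | base => exact rppSum_self_eq_twoRowDet y l2 hab hb
  | succ l1 h ih =>
    have hrange : Finset.range a = (Finset.range m).filter (· < a) := by
      ext c
      simp only [Finset.mem_range, Finset.mem_filter]
      omega
    rw [rppSum_succ_left _ h, ← sum_mul_twoRowDet, hrange, ← sum_fin_ite_eq_sum_filter_range]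
    refine Finset.sum_congr rfl fun c _ => ?_
    split_ifs with hc
    · rw [ih (by omega)]
    · rfl

end ReversePlanePartition

/-- The two-row Jacobi–Trudi formula for dual Grothendieck polynomials:
`g_{(λ₁,λ₂)} = h_{λ₁}(h₀+⋯+h_{λ₂}) − h_{λ₁+1}(h₀+⋯+h_{λ₂-1})`, where the left side is the
RPP generating function: an RPP of shape `(λ₁, λ₂)` is a pair of weakly increasing rows
`T₁ : Fin λ₁ → Fin m`, `T₂ : Fin λ₂ → Fin m` with `T₁ ≤ T₂` columnwise, and its weight is
`∏_i x_i^{c_i(T)}` with `c_i(T)` the number of columns containing `i` (so a two-box column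
with equal entries contributes just one factor). -/
theorem stmt12 {R : Type*} [CommRing R] (m l1 l2 : ℕ) (h2 : 1 ≤ l2) (h12 : l2 ≤ l1)
    (x : Fin m → R) :
    (∑ T ∈ Finset.univ.filter
        (fun T : (Fin l1 → Fin m) × (Fin l2 → Fin m) =>
          Monotone T.1 ∧ Monotone T.2 ∧ ∀ j : Fin l2, T.1 (Fin.castLE h12 j) ≤ T.2 j),
      (∏ j : Fin l2,
          if T.1 (Fin.castLE h12 j) = T.2 j then x (T.2 j)
          else x (T.1 (Fin.castLE h12 j)) * x (T.2 j)) *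
        ∏ j ∈ Finset.univ.filter (fun j : Fin l1 => l2 ≤ (j : ℕ)), x (T.1 j)) =
      hpoly l1 x * (∑ q ∈ Finset.range (l2 + 1), hpoly q x) -
        hpoly (l1 + 1) x * ∑ q ∈ Finset.range l2, hpoly q x := by
  obtain ⟨y, rfl⟩ : ∃ y : ℕ → R, x = fun i : Fin m => y i :=
    ⟨fun i => if h : i < m then x ⟨i, h⟩ else 0, by ext i; simp⟩
  refine Eq.trans ?_ (rppSum_eq_twoRowDet y h12 (le_refl m) (le_refl m))
  rw [Finset.sum_filter, Fintype.sum_prod_type]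
  simp only [rppSum, IsBoundedRPP, Fin.is_lt, implies_true, and_true]
  rfl
end

section
/- The dual Grothendieck polynomial g_{λ/μ}(x_1, …, x_m), defined as ∑_{T ∈ RPP(λ/μ)} ∏_i x_i^{c_i(T)} over reverse plane partitions T of skew shape λ/μ with entries in {1,…,m}, is a symmetric polynomial in x_1, …, x_m. -/
open scoped Classical

/-- The cells (boxes) of the skew Young diagram `λ/μ`, drawn inside `Fin r × Fin N`
(row `i`, column `j` with `μ i ≤ j < λ i`). -/
abbrev SkewCell (r N : ℕ) (lam mu : Fin r → ℕ) : Type :=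
  {p : Fin r × Fin N // mu p.1 ≤ (p.2 : ℕ) ∧ (p.2 : ℕ) < lam p.1}

/-- `T` is a reverse plane partition: entries weakly increase along rows (left to right)
and along columns (top to bottom). -/
def IsRPP {r N m : ℕ} {lam mu : Fin r → ℕ} (T : SkewCell r N lam mu → Fin m) : Prop :=
  (∀ p q : SkewCell r N lam mu,
      p.1.1 = q.1.1 → (p.1.2 : ℕ) + 1 = (q.1.2 : ℕ) → T p ≤ T q) ∧
  (∀ p q : SkewCell r N lam mu,
      (p.1.1 : ℕ) + 1 = (q.1.1 : ℕ) → p.1.2 = q.1.2 → T p ≤ T q)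

/-- `c_v(T)`: the number of columns of `T` containing the entry `v`. -/
noncomputable def colCount {r N m : ℕ} {lam mu : Fin r → ℕ}
    (T : SkewCell r N lam mu → Fin m) (v : Fin m) : ℕ :=
  (Finset.univ.filter fun j : Fin N =>
    ∃ p : SkewCell r N lam mu, p.1.2 = j ∧ T p = v).card

section Transfer

variable {R : Type*} [CommRing R]

/-- The weight in the variable `x` of one column growing from height `a` to height `b`. -/
def growthWeight (x : R) (a b : ℕ) : R :=
  if a = b then 1 else if a < b then x else 0

/-- The sum over weakly decreasing sequences of column heights bounded by `n`, where a column
grows from `a j` to its height with weight `x` and then to `b j` with weight `y`. -/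
def heightSum (x y : R) : (N : ℕ) → (Fin N → ℕ) → (Fin N → ℕ) → ℕ → R
  | 0, _, _, _ => 1
  | N + 1, a, b, n => ∑ i ∈ Finset.range (n + 1),
      growthWeight x (a 0) i * growthWeight y i (b 0) *
        heightSum x y N (Fin.tail a) (Fin.tail b) i

/-- The relation between the partial sums `s` and their images `t` under swapping `x` and `y`
which is preserved when a column is added. -/
def SwapBalanced (x y : R) (a b : ℕ) (s t : ℕ → R) : Prop :=
  (∀ n, b ≤ n → s n = t n) ∧
  ∀ n, a ≤ n → x * y * (s (n + 1) - t (n + 1)) = y * (s (n + 1) - s n) - x * (t (n + 1) - t n)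

lemma sum_growthWeight_of_lt (x y : R) {a b n : ℕ} (h : n < a) (s : ℕ → R) :
    ∑ i ∈ Finset.range (n + 1), growthWeight x a i * growthWeight y i b * s i = 0 := by
  refine Finset.sum_eq_zero fun i hi => ?_
  have hi' := Finset.mem_range.1 hi
  simp [growthWeight, show a ≠ i by omega, show ¬ a < i by omega]

lemma sum_growthWeight_left (x y : R) {a b : ℕ} (s : ℕ → R) :
    ∑ i ∈ Finset.range (a + 1), growthWeight x a i * growthWeight y i b * s i =
      growthWeight y a b * s a := by
  rw [Finset.sum_eq_single_of_mem a (by simp)]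
  · simp [growthWeight]
  · intro i hi hne
    have hi' := Finset.mem_range.1 hi
    simp [growthWeight, show a ≠ i by omega, show ¬ a < i by omega]

lemma SwapBalanced.add_column {x y : R} {a b : ℕ} (hab : a ≤ b) {s t : ℕ → R}
    (h : SwapBalanced x y a b s t) :
    SwapBalanced x y a b
      (fun n => ∑ i ∈ Finset.range (n + 1), growthWeight x a i * growthWeight y i b * s i)
      (fun n => ∑ i ∈ Finset.range (n + 1), growthWeight y a i * growthWeight x i b * t i) := by
  obtain ⟨hP, hQ⟩ := h
  set S := fun n => ∑ i ∈ Finset.range (n + 1), growthWeight x a i * growthWeight y i b * s i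
    with hS
  set T := fun n => ∑ i ∈ Finset.range (n + 1), growthWeight y a i * growthWeight x i b * t i
    with hT
  have hSs (n) : S (n + 1) = S n +
      growthWeight x a (n + 1) * growthWeight y (n + 1) b * s (n + 1) := by
    simp only [hS]; rw [Finset.sum_range_succ]
  have hTs (n) : T (n + 1) = T n +
      growthWeight y a (n + 1) * growthWeight x (n + 1) b * t (n + 1) := by
    simp only [hT]; rw [Finset.sum_range_succ]
  have hSa : S a = growthWeight y a b * s a := sum_growthWeight_left x y s
  have hTa : T a = growthWeight x a b * t a := sum_growthWeight_left y x t
  have hSb (n) (hn : b ≤ n) : S (n + 1) = S n := by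
    simp [hSs, growthWeight, show n + 1 ≠ b by omega, show ¬ n + 1 < b by omega]
  have hTb (n) (hn : b ≤ n) : T (n + 1) = T n := by
    simp [hTs, growthWeight, show n + 1 ≠ b by omega, show ¬ n + 1 < b by omega]
  rcases hab.eq_or_lt with rfl | hlt
  · have hP' : ∀ n, a ≤ n → S n = T n := by
      intro n hn
      induction n, hn using Nat.le_induction with
      | base => simp [hSa, hTa, growthWeight, hP a le_rfl]
      | succ n hn ih => rw [hSb n hn, hTb n hn, ih]
    refine ⟨hP', fun n hn => ?_⟩
    rw [hSb n hn, hTb n hn, hP' n hn]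
    ring
  · have hSm (n) (h1 : a ≤ n) (h2 : n + 1 < b) : S (n + 1) = S n + x * y * s (n + 1) := by
      simp [hSs, growthWeight, show n + 1 ≠ b by omega, h2, show a ≠ n + 1 by omega,
        show a < n + 1 by omega]
    have hTm (n) (h1 : a ≤ n) (h2 : n + 1 < b) : T (n + 1) = T n + x * y * t (n + 1) := by
      simp [hTs, growthWeight, show n + 1 ≠ b by omega, h2, show a ≠ n + 1 by omega,
        show a < n + 1 by omega, mul_comm x y]
    have hSe (n) (h2 : n + 1 = b) : S (n + 1) = S n + x * s (n + 1) := by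
      rw [hSs, h2]
      simp [growthWeight, hlt, hlt.ne]
    have hTe (n) (h2 : n + 1 = b) : T (n + 1) = T n + y * t (n + 1) := by
      rw [hTs, h2]
      simp [growthWeight, hlt, hlt.ne]
    have key : ∀ n, a ≤ n → n < b → S n - T n = y * s n - x * t n := by
      intro n hn
      induction n, hn using Nat.le_induction with
      | base => intro _; simp [hSa, hTa, growthWeight, hlt, hlt.ne]
      | succ n hn ih =>
        intro hb
        rw [hSm n hn hb, hTm n hn hb]
        linear_combination ih (by omega) + hQ n hn
    have hP' : ∀ n, b ≤ n → S n = T n := by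
      intro n hn
      induction n, hn using Nat.le_induction with
      | base =>
        obtain ⟨c, rfl⟩ : ∃ c, b = c + 1 := ⟨b - 1, by omega⟩
        rw [hSe c rfl, hTe c rfl]
        linear_combination key c (by omega) (by omega) + hQ c (by omega) +
          (x + y - x * y) * hP (c + 1) le_rfl
      | succ n hn ih => rw [hSb n hn, hTb n hn, ih]
    refine ⟨hP', fun n hn => ?_⟩
    rcases lt_trichotomy (n + 1) b with h2 | h2 | h2
    · rw [key (n + 1) (by omega) h2, hSm n hn h2, hTm n hn h2]
      ring
    · linear_combination x * y * hP' (n + 1) h2.ge - x * y * hP (n + 1) h2.ge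
        - y * hSe n h2 + x * hTe n h2
    · rw [hSb n (by omega), hTb n (by omega), hP' n (by omega)]
      ring

lemma heightSum_swapBalanced (x y : R) (N : ℕ) (a b : Fin N → ℕ) (ha : Antitone a)
    (hb : Antitone b) (hab : a ≤ b) (A B : ℕ) (hA : ∀ j, a j ≤ A) (hB : ∀ j, b j ≤ B) :
    SwapBalanced x y A B (heightSum x y N a b) (heightSum y x N a b) := by
  induction N generalizing A B with
  | zero => exact ⟨fun _ _ => rfl, fun _ _ => by simp [heightSum]⟩
  | succ N ih =>
    have hmono : Monotone (Fin.succ : Fin N → Fin (N + 1)) := Fin.strictMono_succ.monotone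
    have h := (ih (Fin.tail a) (Fin.tail b) (ha.comp_monotone hmono) (hb.comp_monotone hmono)
      (fun j => hab j.succ) (a 0) (b 0) (fun j => ha (Fin.zero_le _))
      (fun j => hb (Fin.zero_le _))).add_column (hab 0)
    exact ⟨fun n hn => h.1 n ((hB 0).trans hn), fun n hn => h.2 n ((hA 0).trans hn)⟩

lemma antitone_cons_iff {α : Type*} [Preorder α] {N : ℕ} (c₀ : α) (c : Fin N → α) :
    Antitone (Fin.cons c₀ c : Fin (N + 1) → α) ↔ Antitone c ∧ ∀ j, c j ≤ c₀ := by
  constructor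
  · intro h
    refine ⟨fun i j hij => ?_, fun j => ?_⟩
    · simpa using h (Fin.succ_le_succ_iff.2 hij)
    · simpa using h (Fin.zero_le j.succ)
  · rintro ⟨h1, h2⟩ i j hij
    cases i using Fin.cases with
    | zero =>
      cases j using Fin.cases with
      | zero => rfl
      | succ j => simpa using h2 j
    | succ i =>
      cases j using Fin.cases with
      | zero => exact absurd hij (by simp)
      | succ j => simpa using h1 (Fin.succ_le_succ_iff.1 hij)

lemma sum_antitone_eq_heightSum (x y : R) (r N : ℕ) (a b : Fin N → ℕ) (n : ℕ) (hn : n ≤ r) :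
    (∑ c : Fin N → Fin (r + 1), if Antitone c ∧ ∀ j, (c j : ℕ) ≤ n then
      ∏ j, growthWeight x (a j) (c j) * growthWeight y (c j) (b j) else 0) =
      heightSum x y N a b n := by
  induction N generalizing n with
  | zero => simp [heightSum, Subsingleton.antitone]
  | succ N ih =>
    rw [← (Fin.consEquiv fun _ => Fin (r + 1)).sum_comp, Fintype.sum_prod_type]
    have hstep (c₀ : Fin (r + 1)) :
        (∑ c : Fin N → Fin (r + 1),
          if Antitone (Fin.cons c₀ c : Fin (N + 1) → Fin (r + 1)) ∧
              ∀ j, ((Fin.cons c₀ c : Fin (N + 1) → Fin (r + 1)) j : ℕ) ≤ n then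
            ∏ j, growthWeight x (a j) ((Fin.cons c₀ c : Fin (N + 1) → Fin (r + 1)) j) *
              growthWeight y ((Fin.cons c₀ c : Fin (N + 1) → Fin (r + 1)) j) (b j) else 0) =
        if (c₀ : ℕ) ≤ n then growthWeight x (a 0) c₀ * growthWeight y c₀ (b 0) *
          heightSum x y N (Fin.tail a) (Fin.tail b) c₀ else 0 := by
      split_ifs with h
      · rw [← ih (Fin.tail a) (Fin.tail b) c₀ (by omega), Finset.mul_sum]
        refine Finset.sum_congr rfl fun c _ => ?_
        rw [mul_ite, mul_zero, Fin.prod_univ_succ]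
        refine if_congr ?_ (by simp [Fin.tail]) rfl
        rw [antitone_cons_iff, Fin.forall_fin_succ]
        simp only [Fin.cons_zero, Fin.cons_succ, Fin.le_iff_val_le_val]
        exact ⟨fun hc => hc.1, fun hc => ⟨hc, h, fun j => (hc.2 j).trans h⟩⟩
      · refine Finset.sum_eq_zero fun c _ => if_neg fun hc => h ?_
        simpa using hc.2 0
    refine (Finset.sum_congr rfl fun c₀ _ => hstep c₀).trans ?_
    rw [Fin.sum_univ_eq_sum_range (fun i => if i ≤ n then
      growthWeight x (a 0) i * growthWeight y i (b 0) *
        heightSum x y N (Fin.tail a) (Fin.tail b) i else 0) (r + 1), ← Finset.sum_filter,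
      heightSum]
    refine Finset.sum_congr ?_ fun _ _ => rfl
    ext i
    simp only [Finset.mem_filter, Finset.mem_range]
    omega

/-- Weakly decreasing sequences of column heights in the `r × N` rectangle. -/
abbrev Heights (r N : ℕ) : Type := {c : Fin N → Fin (r + 1) // Antitone c}

/-- The one-variable dual Grothendieck transfer matrix. -/
def growthMatrix (r N : ℕ) (x : R) : Matrix (Heights r N) (Heights r N) R :=
  fun a b => ∏ j, growthWeight x (a.1 j) (b.1 j)

lemma growthMatrix_mul_apply (r N : ℕ) (x y : R) (a b : Heights r N) :
    (growthMatrix r N x * growthMatrix r N y) a b =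
      heightSum x y N (fun j => a.1 j) (fun j => b.1 j) r := by
  rw [← sum_antitone_eq_heightSum x y r N _ _ r le_rfl, Matrix.mul_apply]
  simp only [growthMatrix, ← Finset.prod_mul_distrib]
  rw [← Finset.sum_filter]
  refine (Finset.sum_subtype _ (fun c => ?_) (fun c : Fin N → Fin (r + 1) =>
    ∏ j, growthWeight x (a.1 j) (c j) * growthWeight y (c j) (b.1 j))).symm
  simp only [Finset.mem_filter, Finset.mem_univ, true_and, and_iff_left_iff_imp]
  exact fun _ j => Nat.le_of_lt_succ (c j).2

lemma growthMatrix_mul_eq_zero {r N : ℕ} (x y : R) {a b : Heights r N} (h : ¬ a ≤ b) :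
    (growthMatrix r N x * growthMatrix r N y) a b = 0 := by
  obtain ⟨j, hj⟩ : ∃ j, b.1 j < a.1 j := by
    by_contra! hc
    exact h hc
  rw [Matrix.mul_apply]
  refine Finset.sum_eq_zero fun c _ => ?_
  rw [growthMatrix, growthMatrix, ← Finset.prod_mul_distrib]
  refine Finset.prod_eq_zero (Finset.mem_univ j) ?_
  have hj' : (b.1 j : ℕ) < a.1 j := hj
  by_cases hc : (c.1 j : ℕ) < a.1 j
  · rw [growthWeight, if_neg hc.ne', if_neg hc.not_gt, zero_mul]
  · rw [growthWeight.eq_def y, if_neg (by omega), if_neg (by omega), mul_zero]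

lemma growthMatrix_commute (r N : ℕ) (x y : R) :
    Commute (growthMatrix r N x) (growthMatrix r N y) := by
  ext a b
  by_cases h : a ≤ b
  · rw [growthMatrix_mul_apply, growthMatrix_mul_apply]
    exact (heightSum_swapBalanced x y N _ _ (fun i j hij => a.2 hij) (fun i j hij => b.2 hij)
      (fun j => h j) r r (fun j => Nat.le_of_lt_succ (a.1 j).2)
      (fun j => Nat.le_of_lt_succ (b.1 j).2)).1 r le_rfl
  · rw [growthMatrix_mul_eq_zero x y h, growthMatrix_mul_eq_zero y x h]

lemma prod_ofFn_apply {ι : Type*} [Fintype ι] [DecidableEq ι] {m : ℕ}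
    (M : Fin m → Matrix ι ι R) (a b : ι) :
    (List.ofFn M).prod a b = ∑ ν : Fin (m + 1) → ι,
      if ν 0 = a ∧ ν (Fin.last m) = b then ∏ v : Fin m, M v (ν v.castSucc) (ν v.succ) else 0 := by
  induction m generalizing a with
  | zero =>
    rw [← (Equiv.funUnique (Fin 1) ι).symm.sum_comp]
    simp only [List.ofFn_zero, List.prod_nil, Matrix.one_apply, Finset.univ_eq_empty,
      Finset.prod_empty]
    by_cases h : a = b
    · subst h
      rw [Finset.sum_eq_single a] <;> simp +contextual
    · rw [if_neg h, Finset.sum_eq_zero]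
      rintro i -
      refine if_neg ?_
      rintro ⟨rfl, h'⟩
      exact h h'
  | succ m ih =>
    rw [List.ofFn_succ, List.prod_cons, Matrix.mul_apply]
    simp only [ih, Finset.mul_sum]
    rw [Finset.sum_comm, ← (Fin.consEquiv (n := m + 1) fun _ => ι).sum_comp, Fintype.sum_prod_type_right]
    refine Finset.sum_congr rfl fun ν _ => ?_
    simp only [Fin.consEquiv, Equiv.coe_fn_mk, Fin.cons_zero, ← Fin.succ_last, Fin.cons_succ,
      Fin.prod_univ_succ, Fin.castSucc_zero, Fin.castSucc_succ, mul_ite, mul_zero]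
    refine (Fintype.sum_eq_single (ν 0) fun c hc => if_neg fun h => hc h.1.symm).trans ?_
    refine Eq.trans ?_ (Fintype.sum_eq_single a fun c hc => if_neg fun h => hc h.1).symm
    simp

lemma prod_growthMatrix_comp_perm {r N m : ℕ} (x : Fin m → R) (e : Equiv.Perm (Fin m)) :
    (List.ofFn fun v => growthMatrix r N (x (e v))).prod =
      (List.ofFn fun v => growthMatrix r N (x v)).prod := by
  refine List.Perm.prod_eq' (e.ofFn_comp_perm fun v => growthMatrix r N (x v)) ?_
  refine List.pairwise_of_forall_mem_list fun A hA B hB => ?_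
  obtain ⟨i, rfl⟩ := List.mem_ofFn.1 hA
  obtain ⟨j, rfl⟩ := List.mem_ofFn.1 hB
  exact growthMatrix_commute r N _ _

end Transfer

section Levels

variable {r N m : ℕ} {lam mu : Fin r → ℕ}

lemma lt_card_filter_iff {D : Fin r → Prop} (hD : ∀ i' i, i' ≤ i → D i → D i') (i : Fin r) :
    (i : ℕ) < (Finset.univ.filter D).card ↔ D i := by
  constructor
  · intro h
    by_contra hi
    have hsub : Finset.univ.filter D ⊆ Finset.Iio i := by
      intro k hk
      rw [Finset.mem_Iio]
      by_contra! hik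
      exact hi (hD i k hik (Finset.mem_filter.1 hk).2)
    have := Finset.card_le_card hsub
    rw [Fin.card_Iio] at this
    omega
  · intro h
    have hsub : Finset.Iic i ⊆ Finset.univ.filter D := fun k hk =>
      Finset.mem_filter.2 ⟨Finset.mem_univ k, hD k i (Finset.mem_Iic.1 hk) h⟩
    have := Finset.card_le_card hsub
    rw [Fin.card_Iic] at this
    omega

/-- The column heights of an order ideal of the `r × N` rectangle. -/
noncomputable def idealHeights (D : Fin r → Fin N → Prop)
    (hcol : ∀ i j' j, j' ≤ j → D i j → D i j') : Heights r N :=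
  ⟨fun j => ⟨(Finset.univ.filter fun i => D i j).card,
      Nat.lt_succ_of_le ((Finset.card_filter_le _ _).trans (by simp))⟩,
    fun j' j h => Finset.card_le_card fun i hi => by
      simp only [Finset.mem_filter, Finset.mem_univ, true_and] at hi ⊢
      exact hcol i j' j h hi⟩

lemma lt_idealHeights_iff {D : Fin r → Fin N → Prop}
    (hrow : ∀ i' i j, i' ≤ i → D i j → D i' j) (hcol : ∀ i j' j, j' ≤ j → D i j → D i j')
    (i : Fin r) (j : Fin N) : (i : ℕ) < (idealHeights D hcol).1 j ↔ D i j :=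
  lt_card_filter_iff (fun i' i h => hrow i' i j h) i

lemma idealHeights_mono {D D' : Fin r → Fin N → Prop}
    (hcol : ∀ i j' j, j' ≤ j → D i j → D i j') (hcol' : ∀ i j' j, j' ≤ j → D' i j → D' i j')
    (h : ∀ i j, D i j → D' i j) : idealHeights D hcol ≤ idealHeights D' hcol' := by
  intro j
  change (Finset.univ.filter fun i => D i j).card ≤ (Finset.univ.filter fun i => D' i j).card
  exact Finset.card_le_card (Finset.monotone_filter_right _ fun i _ => h i j)

lemma Heights.ext_lt {a b : Heights r N}
    (h : ∀ (i : Fin r) (j : Fin N), (i : ℕ) < a.1 j ↔ (i : ℕ) < b.1 j) : a = b := by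
  refine Subtype.ext (funext fun j => Fin.ext ?_)
  have ha := (a.1 j).2
  have hb := (b.1 j).2
  by_contra hne
  rcases Nat.lt_or_gt_of_ne hne with hlt | hlt
  · exact absurd ((h ⟨a.1 j, by omega⟩ j).2 hlt) (lt_irrefl _)
  · exact absurd ((h ⟨b.1 j, by omega⟩ j).1 hlt) (lt_irrefl _)

/-- The column heights of the Young diagram with row lengths `lam`. -/
noncomputable def rowHeights (N : ℕ) (lam : Fin r → ℕ) : Heights r N :=
  idealHeights (fun i j => (j : ℕ) < lam i) fun _ _ _ h hj => lt_of_le_of_lt h hj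

lemma lt_rowHeights_iff (hlam : Antitone lam) (i : Fin r) (j : Fin N) :
    (i : ℕ) < (rowHeights N lam).1 j ↔ (j : ℕ) < lam i :=
  lt_idealHeights_iff (D := fun i j => (j : ℕ) < lam i)
    (fun _ _ _ h hj => lt_of_lt_of_le hj (hlam h)) _ i j

/-- The box `(i, j)` lies in `μ` or carries an entry of `T` smaller than `v`. -/
def IsBelow (T : SkewCell r N lam mu → Fin m) (v : ℕ) (i : Fin r) (j : Fin N) : Prop :=
  (j : ℕ) < mu i ∨ ∃ h : mu i ≤ (j : ℕ) ∧ (j : ℕ) < lam i, (T ⟨(i, j), h⟩ : ℕ) < v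

lemma isBelow_cell_iff (T : SkewCell r N lam mu → Fin m) (v : ℕ) (p : SkewCell r N lam mu) :
    IsBelow T v p.1.1 p.1.2 ↔ (T p : ℕ) < v :=
  ⟨fun h => h.elim (fun h => absurd h p.2.1.not_gt) fun ⟨_, h⟩ => h, fun h => Or.inr ⟨p.2, h⟩⟩

lemma IsRPP.isBelow_of_row_le {T : SkewCell r N lam mu → Fin m} (hT : IsRPP T)
    (hlam : Antitone lam) (hmu : Antitone mu) (v : ℕ) (i' i : Fin r) (j : Fin N) (h : i' ≤ i)
    (hi : IsBelow T v i j) : IsBelow T v i' j := by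
  obtain ⟨d, hd⟩ := Nat.exists_eq_add_of_le (Fin.le_def.1 h)
  clear h
  induction d generalizing i with
  | zero => rwa [show i' = i from Fin.ext (by omega)]
  | succ d ih =>
    let k : Fin r := ⟨i' + d, by omega⟩
    have hk : (k : ℕ) + 1 = i := by simp only [k]; omega
    have hki : k ≤ i := Fin.le_def.2 (by omega)
    refine ih k ?_ rfl
    rcases hi with hi | ⟨hc, hv⟩
    · exact Or.inl (hi.trans_le (hmu hki))
    · by_cases hm : (j : ℕ) < mu k
      · exact Or.inl hm
      · refine Or.inr ⟨⟨not_lt.1 hm, hc.2.trans_le (hlam hki)⟩, ?_⟩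
        exact lt_of_le_of_lt (hT.2 ⟨(k, j), _⟩ ⟨(i, j), hc⟩ hk rfl) hv

lemma IsRPP.isBelow_of_col_le {T : SkewCell r N lam mu → Fin m} (hT : IsRPP T)
    (v : ℕ) (i : Fin r) (j' j : Fin N) (h : j' ≤ j)
    (hj : IsBelow T v i j) : IsBelow T v i j' := by
  obtain ⟨d, hd⟩ := Nat.exists_eq_add_of_le (Fin.le_def.1 h)
  clear h
  induction d generalizing j with
  | zero => rwa [show j' = j from Fin.ext (by omega)]
  | succ d ih =>
    let k : Fin N := ⟨j' + d, by omega⟩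
    have hk : (k : ℕ) + 1 = j := by simp only [k]; omega
    refine ih k ?_ rfl
    rcases hj with hj | ⟨hc, hv⟩
    · exact Or.inl (by omega)
    · by_cases hm : (k : ℕ) < mu i
      · exact Or.inl hm
      · refine Or.inr ⟨⟨not_lt.1 hm, by omega⟩, ?_⟩
        exact lt_of_le_of_lt (hT.1 ⟨(i, k), _⟩ ⟨(i, j), hc⟩ rfl hk) hv

/-- The column heights of the region of `μ` together with the entries of `T` smaller than `v`. -/
noncomputable def IsRPP.levels {T : SkewCell r N lam mu → Fin m} (hT : IsRPP T)
    (v : Fin (m + 1)) : Heights r N :=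
  idealHeights (IsBelow T v) (hT.isBelow_of_col_le v)

lemma IsRPP.lt_levels_iff {T : SkewCell r N lam mu → Fin m} (hT : IsRPP T)
    (hlam : Antitone lam) (hmu : Antitone mu) (v : Fin (m + 1)) (i : Fin r) (j : Fin N) :
    (i : ℕ) < (hT.levels v).1 j ↔ IsBelow T v i j :=
  lt_idealHeights_iff (hT.isBelow_of_row_le hlam hmu v) _ i j

lemma IsRPP.levels_zero {T : SkewCell r N lam mu → Fin m} (hT : IsRPP T)
    (hlam : Antitone lam) (hmu : Antitone mu) : hT.levels 0 = rowHeights N mu := by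
  refine Heights.ext_lt fun i j => ?_
  rw [hT.lt_levels_iff hlam hmu, lt_rowHeights_iff hmu]
  simp [IsBelow]

lemma IsRPP.levels_last {T : SkewCell r N lam mu → Fin m} (hT : IsRPP T)
    (hlam : Antitone lam) (hmu : Antitone mu) (hsub : ∀ i, mu i ≤ lam i) :
    hT.levels (Fin.last m) = rowHeights N lam := by
  refine Heights.ext_lt fun i j => ?_
  rw [hT.lt_levels_iff hlam hmu, lt_rowHeights_iff hlam]
  have := hsub i
  simp only [IsBelow, Fin.val_last, Fin.is_lt, exists_prop, and_true]
  omega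

lemma IsRPP.levels_mono {T : SkewCell r N lam mu → Fin m} (hT : IsRPP T) (v : Fin m) :
    hT.levels v.castSucc ≤ hT.levels v.succ := by
  refine idealHeights_mono _ _ fun i j => Or.imp_right fun ⟨h, hv⟩ => ⟨h, hv.trans ?_⟩
  simp

lemma IsRPP.colCount_eq {T : SkewCell r N lam mu → Fin m} (hT : IsRPP T)
    (hlam : Antitone lam) (hmu : Antitone mu) (v : Fin m) :
    colCount T v = (Finset.univ.filter fun j : Fin N =>
      ((hT.levels v.castSucc).1 j : ℕ) < (hT.levels v.succ).1 j).card := by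
  refine congrArg Finset.card (Finset.filter_congr fun j _ => ?_)
  constructor
  · rintro ⟨p, rfl, hp⟩
    have h1 := hT.lt_levels_iff hlam hmu v.castSucc p.1.1 p.1.2
    have h2 := hT.lt_levels_iff hlam hmu v.succ p.1.1 p.1.2
    rw [isBelow_cell_iff, hp] at h1 h2
    simp only [Fin.val_castSucc, Fin.val_succ] at h1 h2
    omega
  · intro h
    let i : Fin r := ⟨(hT.levels v.castSucc).1 j, by have := ((hT.levels v.succ).1 j).2; omega⟩
    have h1 := mt (hT.lt_levels_iff hlam hmu v.castSucc i j).2 (lt_irrefl _)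
    rcases (hT.lt_levels_iff hlam hmu v.succ i j).1 h with hi | ⟨hc, hv⟩
    · exact absurd (Or.inl hi) h1
    · refine ⟨⟨(i, j), hc⟩, rfl, Fin.ext ?_⟩
      have h2 : ¬ (T ⟨(i, j), hc⟩ : ℕ) < v := fun hlt => h1 (Or.inr ⟨hc, hlt⟩)
      rw [Fin.val_succ] at hv
      omega

lemma IsRPP.eq_of_levels_eq {T T' : SkewCell r N lam mu → Fin m} (hT : IsRPP T) (hT' : IsRPP T')
    (hlam : Antitone lam) (hmu : Antitone mu) (h : hT.levels = hT'.levels) : T = T' := by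
  funext p
  have key (v : Fin (m + 1)) : (T p : ℕ) < v ↔ (T' p : ℕ) < v := by
    rw [← isBelow_cell_iff, ← isBelow_cell_iff, ← hT.lt_levels_iff hlam hmu,
      ← hT'.lt_levels_iff hlam hmu, h]
  have h1 := key (T p).succ
  have h2 := key (T' p).succ
  rw [Fin.val_succ] at h1 h2
  exact Fin.ext (by omega)

lemma exists_levels_eq (hlam : Antitone lam) (hmu : Antitone mu)
    (ν : Fin (m + 1) → Heights r N) (h0 : ν 0 = rowHeights N mu)
    (h1 : ν (Fin.last m) = rowHeights N lam) (hν : ∀ v : Fin m, ν v.castSucc ≤ ν v.succ) :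
    ∃ (T : SkewCell r N lam mu → Fin m) (hT : IsRPP T), hT.levels = ν := by
  have hmono : Monotone ν := Fin.monotone_iff_le_succ.2 hν
  have hex (p : SkewCell r N lam mu) :
      ∃ t : Fin m, ∀ v : Fin (m + 1), (t : ℕ) < v ↔ (p.1.1 : ℕ) < (ν v).1 p.1.2 := by
    have hlast : ∃ n, ∃ hn : n < m + 1, (p.1.1 : ℕ) < (ν ⟨n, hn⟩).1 p.1.2 :=
      ⟨m, m.lt_succ_self, by
        change _ < ((ν (Fin.last m)).1 p.1.2 : ℕ)
        rw [h1, lt_rowHeights_iff hlam]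
        exact p.2.2⟩
    obtain ⟨hn, hlt⟩ := Nat.find_spec hlast
    have hpos : Nat.find hlast ≠ 0 := by
      intro hz
      simp only [hz] at hlt
      change _ < ((ν 0).1 p.1.2 : ℕ) at hlt
      rw [h0, lt_rowHeights_iff hmu] at hlt
      exact absurd hlt p.2.1.not_gt
    refine ⟨⟨Nat.find hlast - 1, by omega⟩, fun v => ⟨fun hv => ?_, fun hv => ?_⟩⟩
    · have hle : (⟨Nat.find hlast, hn⟩ : Fin (m + 1)) ≤ v := by
        rw [Fin.le_def]
        simp only at hv ⊢
        omega
      exact hlt.trans_le (hmono hle p.1.2)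
    · have := Nat.find_min' hlast ⟨v.2, hv⟩
      simp only
      omega
  choose T hTν using hex
  have hle {p q : SkewCell r N lam mu}
      (h : ∀ v, (q.1.1 : ℕ) < (ν v).1 q.1.2 → (p.1.1 : ℕ) < (ν v).1 p.1.2) : T p ≤ T q := by
    have := (hTν p (T q).succ).2 (h _ ((hTν q (T q).succ).1 (by simp)))
    rw [Fin.val_succ] at this
    exact Fin.le_def.2 (by omega)
  have hT : IsRPP T := by
    refine ⟨fun p q hrow hcol => hle fun v hv => ?_, fun p q hrow hcol => hle fun v hv => ?_⟩
    · rw [hrow]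
      exact hv.trans_le ((ν v).2 (Fin.le_def.2 (by omega)))
    · rw [hcol]
      omega
  refine ⟨T, hT, funext fun v => Heights.ext_lt fun i j => ?_⟩
  rw [hT.lt_levels_iff hlam hmu]
  constructor
  · rintro (h | ⟨hc, h⟩)
    · rw [← lt_rowHeights_iff hmu, ← h0] at h
      exact h.trans_le (hmono (Fin.zero_le v) j)
    · exact (hTν ⟨(i, j), hc⟩ v).1 h
  · intro h
    by_cases hj : (j : ℕ) < mu i
    · exact Or.inl hj
    · have hl : (i : ℕ) < (ν (Fin.last m)).1 j := h.trans_le (hmono (Fin.le_last v) j)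
      rw [h1, lt_rowHeights_iff hlam] at hl
      exact Or.inr ⟨⟨not_lt.1 hj, hl⟩, (hTν ⟨(i, j), _⟩ v).2 h⟩

variable {R : Type*} [CommRing R]

lemma growthMatrix_apply_of_le (x : R) {a b : Heights r N} (h : a ≤ b) :
    growthMatrix r N x a b =
      x ^ (Finset.univ.filter fun j : Fin N => (a.1 j : ℕ) < b.1 j).card := by
  rw [← Finset.prod_const, Finset.prod_filter, growthMatrix]
  refine Finset.prod_congr rfl fun j _ => ?_
  have hj : (a.1 j : ℕ) ≤ b.1 j := h j
  rcases hj.eq_or_lt with hj | hj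
  · simp [growthWeight, hj]
  · rw [growthWeight, if_neg hj.ne]
    simp only [hj, if_true]

lemma growthMatrix_apply_of_not_le (x : R) {a b : Heights r N} (h : ¬ a ≤ b) :
    growthMatrix r N x a b = 0 := by
  obtain ⟨j, hj⟩ : ∃ j, b.1 j < a.1 j := by
    by_contra! hc
    exact h hc
  have hj' : (b.1 j : ℕ) < a.1 j := hj
  refine Finset.prod_eq_zero (Finset.mem_univ j) ?_
  rw [growthWeight, if_neg hj'.ne', if_neg hj'.not_gt]

lemma sum_isRPP_eq_prod_growthMatrix (hlam : Antitone lam) (hmu : Antitone mu)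
    (hsub : ∀ i, mu i ≤ lam i) (x : Fin m → R) :
    ∑ T ∈ Finset.univ.filter (IsRPP (r := r) (N := N) (m := m) (lam := lam) (mu := mu)),
        ∏ v : Fin m, x v ^ colCount T v =
      (List.ofFn fun v => growthMatrix r N (x v)).prod (rowHeights N mu) (rowHeights N lam) := by
  rw [prod_ofFn_apply, ← Finset.sum_filter]
  have hchain := Finset.sum_subset (f := fun ν : Fin (m + 1) → Heights r N =>
      ∏ v : Fin m, growthMatrix r N (x v) (ν v.castSucc) (ν v.succ))
    (Finset.filter_subset (fun ν : Fin (m + 1) → Heights r N =>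
      ∀ v : Fin m, ν v.castSucc ≤ ν v.succ)
      (Finset.univ.filter fun ν => ν 0 = rowHeights N mu ∧ ν (Fin.last m) = rowHeights N lam))
    (fun ν hν hν' => by
      obtain ⟨v, hv⟩ : ∃ v : Fin m, ¬ ν v.castSucc ≤ ν v.succ := by
        by_contra! hc
        exact hν' (Finset.mem_filter.2 ⟨hν, hc⟩)
      exact Finset.prod_eq_zero (Finset.mem_univ v) (growthMatrix_apply_of_not_le _ hv))
  rw [← hchain]
  refine Finset.sum_bij (fun T hT => (Finset.mem_filter.1 hT).2.levels) ?_ ?_ ?_ ?_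
  · intro T hT
    have hT' := (Finset.mem_filter.1 hT).2
    simp only [Finset.mem_filter, Finset.mem_univ, true_and]
    exact ⟨⟨hT'.levels_zero hlam hmu, hT'.levels_last hlam hmu hsub⟩, hT'.levels_mono⟩
  · exact fun T _ T' _ h => IsRPP.eq_of_levels_eq _ _ hlam hmu h
  · intro ν hν
    simp only [Finset.mem_filter, Finset.mem_univ, true_and] at hν
    obtain ⟨T, hT, h⟩ := exists_levels_eq hlam hmu ν hν.1.1 hν.1.2 hν.2
    exact ⟨T, Finset.mem_filter.2 ⟨Finset.mem_univ T, hT⟩, h⟩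
  · intro T hT
    refine Finset.prod_congr rfl fun v _ => ?_
    rw [growthMatrix_apply_of_le _ (IsRPP.levels_mono _ v), IsRPP.colCount_eq _ hlam hmu]

end Levels

/-- The skew dual Grothendieck polynomial
`g_{λ/μ}(x₁,…,x_m) = ∑_{T ∈ RPP(λ/μ)} ∏_v x_v^{c_v(T)}` is a symmetric polynomial. -/
theorem stmt15 (m r N : ℕ) (lam mu : Fin r → ℕ)
    (hlam : Antitone lam) (hmu : Antitone mu)
    (hsub : ∀ i, mu i ≤ lam i) (hbd : ∀ i, lam i ≤ N) :
    MvPolynomial.IsSymmetric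
      (∑ T ∈ Finset.univ.filter (IsRPP (r := r) (N := N) (m := m) (lam := lam) (mu := mu)),
        ∏ v : Fin m, (MvPolynomial.X v : MvPolynomial (Fin m) ℤ) ^ colCount T v) := by
  intro e
  simp only [map_sum, map_prod, map_pow, MvPolynomial.rename_X]
  rw [sum_isRPP_eq_prod_growthMatrix hlam hmu hsub fun v =>
      (MvPolynomial.X (e v) : MvPolynomial (Fin m) ℤ),
    sum_isRPP_eq_prod_growthMatrix hlam hmu hsub MvPolynomial.X,
    prod_growthMatrix_comp_perm MvPolynomial.X e]
end
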